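/- arXiv:1303.3881 — 2 statements merged into one kernel-verified Lean document; each statement's English description precedes it below -/
import Mathlib

section
/- Let Y be the number of vertices of degree at most k in the random graph G(n,p) with p < 1. Then Var(Y) ≤ (E Y)² · (p/(1−p) + 1/E Y). -/
open scoped Classical

/-- The number of edges of a graph on `Fin n`. -/
noncomputable def edgeCount (n : ℕ) (G : SimpleGraph (Fin n)) : ℕ :=
  G.edgeFinset.card

/-- The probability that the Erdős–Rényi random graph `G(n,p)` equals the fixed graph `G`. -/
noncomputable def erWeight (n : ℕ) (p : ℝ) (G : SimpleGraph (Fin n)) : ℝ :=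
  p ^ edgeCount n G * (1 - p) ^ (n.choose 2 - edgeCount n G)

/-- The probability that `G(n,p)` lies in the set of graphs `A`. -/
noncomputable def erProb (n : ℕ) (p : ℝ) (A : Set (SimpleGraph (Fin n))) : ℝ :=
  ∑ G : SimpleGraph (Fin n), if G ∈ A then erWeight n p G else 0

/-- Expectation of a real-valued function of `G(n,p)`. -/
noncomputable def erExp (n : ℕ) (p : ℝ) (f : SimpleGraph (Fin n) → ℝ) : ℝ :=
  ∑ G : SimpleGraph (Fin n), erWeight n p G * f G

/-- Variance of a real-valued function of `G(n,p)`. -/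
noncomputable def erVar (n : ℕ) (p : ℝ) (f : SimpleGraph (Fin n) → ℝ) : ℝ :=
  erExp n p fun G => (f G - erExp n p f) ^ 2

/-- `Y(G)`: the number of vertices of `G` of degree at most `k`. -/
noncomputable def lowDegCount (n k : ℕ) (G : SimpleGraph (Fin n)) : ℝ :=
  ((Finset.univ.filter fun v => G.degree v ≤ k).card : ℝ)

/-- Expectation of `f S` for a random subset `S` of `E` containing each element independently
with probability `p`. -/
noncomputable def subsetExp {α : Type*} (p : ℝ) (E : Finset α) (f : Finset α → ℝ) : ℝ :=
  ∑ S ∈ E.powerset, p ^ S.card * (1 - p) ^ (E.card - S.card) * f S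

section subsetExp

variable {α : Type*} {p : ℝ}

theorem subsetExp_congr {E : Finset α} {f g : Finset α → ℝ} (h : ∀ S ⊆ E, f S = g S) :
    subsetExp p E f = subsetExp p E g :=
  Finset.sum_congr rfl fun S hS => by rw [h S (Finset.mem_powerset.1 hS)]

theorem subsetExp_mono (hp0 : 0 ≤ p) (hp1 : p ≤ 1) {E : Finset α} {f g : Finset α → ℝ}
    (h : ∀ S ⊆ E, f S ≤ g S) : subsetExp p E f ≤ subsetExp p E g :=
  Finset.sum_le_sum fun S hS => mul_le_mul_of_nonneg_left (h S (Finset.mem_powerset.1 hS))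
    (mul_nonneg (pow_nonneg hp0 _) (pow_nonneg (sub_nonneg.2 hp1) _))

theorem subsetExp_nonneg (hp0 : 0 ≤ p) (hp1 : p ≤ 1) {E : Finset α} {f : Finset α → ℝ}
    (h : ∀ S ⊆ E, 0 ≤ f S) : 0 ≤ subsetExp p E f :=
  Finset.sum_nonneg fun S hS => mul_nonneg
    (mul_nonneg (pow_nonneg hp0 _) (pow_nonneg (sub_nonneg.2 hp1) _))
    (h S (Finset.mem_powerset.1 hS))

theorem subsetExp_mul_const (E : Finset α) (f : Finset α → ℝ) (c : ℝ) :
    subsetExp p E (fun S => f S * c) = subsetExp p E f * c := by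
  simp only [subsetExp, Finset.sum_mul, mul_assoc]

theorem subsetExp_const_mul (E : Finset α) (f : Finset α → ℝ) (c : ℝ) :
    subsetExp p E (fun S => c * f S) = c * subsetExp p E f := by
  simp only [mul_comm c, subsetExp_mul_const]

theorem subsetExp_sum {ι : Type*} (E : Finset α) (s : Finset ι) (f : ι → Finset α → ℝ) :
    subsetExp p E (fun S => ∑ i ∈ s, f i S) = ∑ i ∈ s, subsetExp p E (f i) := by
  simp only [subsetExp, Finset.mul_sum]
  exact Finset.sum_comm

theorem subsetExp_empty (f : Finset α → ℝ) : subsetExp p ∅ f = f ∅ := by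
  simp [subsetExp]

/-- Conditioning on whether `a` belongs to the random subset. -/
theorem subsetExp_insert [DecidableEq α] {a : α} {E : Finset α} (ha : a ∉ E) (f : Finset α → ℝ) :
    subsetExp p (insert a E) f =
      p * subsetExp p E (fun S => f (insert a S)) + (1 - p) * subsetExp p E f := by
  rw [subsetExp, Finset.sum_powerset_insert ha, add_comm, subsetExp, subsetExp, Finset.mul_sum,
    Finset.mul_sum]
  congr 1 <;> refine Finset.sum_congr rfl fun S hS => ?_
  · have hS := Finset.mem_powerset.1 hS
    rw [Finset.card_insert_of_notMem ha, Finset.card_insert_of_notMem fun h => ha (hS h),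
      Nat.add_sub_add_right]
    ring
  · have hS := Finset.card_le_card (Finset.mem_powerset.1 hS)
    rw [Finset.card_insert_of_notMem ha, Nat.sub_add_comm hS]
    ring

theorem subsetExp_const (E : Finset α) (c : ℝ) : subsetExp p E (fun _ => c) = c := by
  induction E using Finset.induction_on with
  | empty => exact subsetExp_empty _
  | insert a E ha ih => rw [subsetExp_insert ha, ih]; ring

/-- Fubini: a random subset of a disjoint union is the union of independent random subsets. -/
theorem subsetExp_union [DecidableEq α] {A C : Finset α} (h : Disjoint A C) (f : Finset α → ℝ) :
    subsetExp p (A ∪ C) f = subsetExp p A fun S => subsetExp p C fun T => f (S ∪ T) := by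
  induction A using Finset.induction_on generalizing f with
  | empty => simp [subsetExp_empty]
  | insert a A ha ih =>
    rw [Finset.disjoint_insert_left] at h
    rw [Finset.insert_union, subsetExp_insert (by simp [ha, h.1]), subsetExp_insert ha,
      ih h.2, ih h.2]
    simp only [Finset.insert_union]

/-- Functions depending on the traces of the random subset on disjoint sets are independent. -/
theorem subsetExp_mul_of_disjoint [DecidableEq α] {A C : Finset α} (hAC : Disjoint A C)
    {g h : Finset α → ℝ}
    (hg : ∀ S ⊆ A, ∀ T ⊆ C, g (S ∪ T) = g S) (hh : ∀ S ⊆ A, ∀ T ⊆ C, h (S ∪ T) = h T) :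
    subsetExp p (A ∪ C) (fun S => g S * h S) =
      subsetExp p (A ∪ C) g * subsetExp p (A ∪ C) h := by
  have hgA : subsetExp p (A ∪ C) g = subsetExp p A g := by
    rw [subsetExp_union hAC]
    refine subsetExp_congr fun S hS => ?_
    rw [subsetExp_congr (hg S hS), subsetExp_const]
  have hhC : subsetExp p (A ∪ C) h = subsetExp p C h := by
    rw [subsetExp_union hAC, subsetExp_congr fun S hS => subsetExp_congr (hh S hS),
      subsetExp_const]
  rw [hgA, hhC, subsetExp_union hAC, ← subsetExp_mul_const]
  refine subsetExp_congr fun S hS => ?_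
  rw [← subsetExp_const_mul]
  exact subsetExp_congr fun T hT => by rw [hg S hS T hT, hh S hS T hT]

end subsetExp

/-- The indicator that `v` has degree at most `k` in the graph with edge set `S`. -/
noncomputable def lowDeg {V : Type*} (k : ℕ) (v : V) (S : Finset (Sym2 V)) : ℝ :=
  if (S.filter (v ∈ ·)).card ≤ k then 1 else 0

section lowDeg

variable {V : Type*} {k : ℕ} {p : ℝ}

theorem lowDeg_nonneg (v : V) (S : Finset (Sym2 V)) : 0 ≤ lowDeg k v S := by
  unfold lowDeg; split_ifs <;> norm_num

theorem lowDeg_mul_self (v : V) (S : Finset (Sym2 V)) :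
    lowDeg k v S * lowDeg k v S = lowDeg k v S := by
  unfold lowDeg; split_ifs <;> norm_num

theorem lowDeg_anti (v : V) {S T : Finset (Sym2 V)} (h : S ⊆ T) : lowDeg k v T ≤ lowDeg k v S := by
  have := Finset.card_le_card (Finset.filter_subset_filter (v ∈ ·) h)
  unfold lowDeg; split_ifs <;> first | omega | norm_num

theorem lowDeg_union_left {v : V} {S T : Finset (Sym2 V)} (hT : ∀ e ∈ T, v ∉ e) :
    lowDeg k v (S ∪ T) = lowDeg k v S := by
  rw [lowDeg, lowDeg, Finset.filter_union, Finset.filter_false_of_mem hT, Finset.union_empty]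

theorem lowDeg_union_right {v : V} {S T : Finset (Sym2 V)} (hS : ∀ e ∈ S, v ∉ e) :
    lowDeg k v (S ∪ T) = lowDeg k v T := by
  rw [Finset.union_comm, lowDeg_union_left hS]

/-- Away from the edge `s(u, v)`, the neighbourhoods of `u` and `v` are independent. -/
theorem subsetExp_lowDeg_mul {u v : V} (huv : u ≠ v) {E : Finset (Sym2 V)}
    (hE : s(u, v) ∉ E) (D : Finset (Sym2 V)) :
    subsetExp p E (fun S => lowDeg k u (D ∪ S) * lowDeg k v (D ∪ S)) =
      subsetExp p E (fun S => lowDeg k u (D ∪ S)) *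
        subsetExp p E (fun S => lowDeg k v (D ∪ S)) := by
  have hsplit := Finset.filter_union_filter_not_eq (fun e => u ∈ e) E
  rw [← hsplit]
  refine subsetExp_mul_of_disjoint (g := fun S => lowDeg k u (D ∪ S))
    (h := fun S => lowDeg k v (D ∪ S)) (Finset.disjoint_filter_filter_not E E _)
    (fun S _ T hT => ?_) fun S hS T _ => ?_
  · rw [← Finset.union_assoc]
    exact lowDeg_union_left fun e he => (Finset.mem_filter.1 (hT he)).2
  · rw [Finset.union_left_comm]
    refine lowDeg_union_right fun e he hv => ?_
    obtain ⟨heE, hu⟩ := Finset.mem_filter.1 (hS he)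
    exact hE (((Sym2.mem_and_mem_iff huv).1 ⟨hu, hv⟩) ▸ heE)

theorem one_sub_mul_subsetExp_lowDeg_mul_le (hp0 : 0 ≤ p) (hp1 : p ≤ 1) {u v : V} (huv : u ≠ v)
    {E : Finset (Sym2 V)} (hE : s(u, v) ∈ E) :
    (1 - p) * subsetExp p E (fun S => lowDeg k u S * lowDeg k v S) ≤
      subsetExp p E (lowDeg k u) * subsetExp p E (lowDeg k v) := by
  obtain ⟨E, huvE, rfl⟩ : ∃ E', s(u, v) ∉ E' ∧ insert s(u, v) E' = E :=
    ⟨E.erase s(u, v), Finset.notMem_erase _ _, Finset.insert_erase hE⟩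
  have hpresent := subsetExp_lowDeg_mul (k := k) (p := p) huv huvE {s(u, v)}
  have habsent := subsetExp_lowDeg_mul (k := k) (p := p) huv huvE ∅
  simp only [← Finset.insert_eq, Finset.empty_union] at hpresent habsent
  have hanti (w : V) : subsetExp p E (fun S => lowDeg k w (insert s(u, v) S)) ≤
      subsetExp p E (fun S => lowDeg k w S) :=
    subsetExp_mono hp0 hp1 fun S _ => lowDeg_anti w (Finset.subset_insert _ _)
  have hnonneg (w : V) : 0 ≤ subsetExp p E (fun S => lowDeg k w (insert s(u, v) S)) :=
    subsetExp_nonneg hp0 hp1 fun S _ => lowDeg_nonneg w _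
  simp only [subsetExp_insert huvE, hpresent, habsent]
  have hu := hanti u
  have hv := hanti v
  have hu0 := hnonneg u
  have hv0 := hnonneg v
  generalize subsetExp p E (fun S => lowDeg k u (insert s(u, v) S)) = b at *
  generalize subsetExp p E (fun S => lowDeg k v (insert s(u, v) S)) = b' at *
  change (1 - p) * (p * (b * b') + (1 - p) * (subsetExp p E (lowDeg k u) *
    subsetExp p E (lowDeg k v))) ≤ _
  generalize subsetExp p E (lowDeg k u) = a at *
  generalize subsetExp p E (lowDeg k v) = a' at *
  have hq : 0 ≤ p * (1 - p) := mul_nonneg hp0 (sub_nonneg.2 hp1)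
  have hcross : p * (1 - p) * (b * b') ≤ p * (1 - p) * (a * b') :=
    mul_le_mul_of_nonneg_left (mul_le_mul_of_nonneg_right hu hv0) hq
  have hcross' : 0 ≤ p * (1 - p) * (a' * b) :=
    mul_nonneg hq (mul_nonneg (hv0.trans hv) hu0)
  have hsq : 0 ≤ p ^ 2 * (b * b') := mul_nonneg (sq_nonneg p) (mul_nonneg hu0 hv0)
  linarith

end lowDeg

/-- The random graph `G(n,p)` is a random subset of the edges of the complete graph. -/
theorem erExp_eq_subsetExp (n : ℕ) (p : ℝ) (f : Finset (Sym2 (Fin n)) → ℝ) :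
    erExp n p (fun G => f G.edgeFinset) =
      subsetExp p (⊤ : SimpleGraph (Fin n)).edgeFinset f := by
  refine Finset.sum_bij' (fun G _ => G.edgeFinset)
    (fun S _ => SimpleGraph.fromEdgeSet (S : Set (Sym2 (Fin n)))) ?_ ?_ ?_ ?_ ?_
  · intro G _
    exact Finset.mem_powerset.2 (SimpleGraph.edgeFinset_mono le_top)
  · simp
  · intro G _
    simp
  · intro S hS
    ext e
    have hS : e ∈ S → e ∈ (⊤ : SimpleGraph (Fin n)).edgeFinset :=
      fun he => Finset.mem_powerset.1 hS he
    simpa using hS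
  · intro G _
    rw [erWeight, edgeCount, SimpleGraph.card_edgeFinset_top_eq_card_choose_two, Fintype.card_fin]

theorem lowDegCount_eq_sum_lowDeg (n k : ℕ) (G : SimpleGraph (Fin n)) :
    lowDegCount n k G = ∑ v, lowDeg k v G.edgeFinset := by
  rw [lowDegCount, Finset.card_filter, Nat.cast_sum]
  refine Finset.sum_congr rfl fun v _ => ?_
  rw [lowDeg, ← SimpleGraph.incidenceFinset_eq_filter, SimpleGraph.card_incidenceFinset_eq_degree]
  push_cast
  rfl

theorem erVar_eq (n : ℕ) (p : ℝ) (f : SimpleGraph (Fin n) → ℝ) :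
    erVar n p f = erExp n p (fun G => f G ^ 2) - erExp n p f ^ 2 := by
  have htotal : ∑ G, erWeight n p G = 1 := by
    have := erExp_eq_subsetExp n p fun _ => 1
    rw [subsetExp_const] at this
    simpa [erExp] using this
  rw [erVar]
  generalize hm : erExp n p f = m
  have hexpand : erExp n p (fun G => (f G - m) ^ 2) =
      erExp n p (fun G => f G ^ 2) - 2 * m * erExp n p f + m ^ 2 * ∑ G, erWeight n p G := by
    simp only [erExp, Finset.mul_sum, ← Finset.sum_sub_distrib, ← Finset.sum_add_distrib]
    exact Finset.sum_congr rfl fun G _ => by ring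
  rw [hexpand, hm, htotal]
  ring

/-- If `Y` is the number of vertices of degree at most `k` in `G(n,p)` with `p < 1`, then
`Var(Y) ≤ (E Y)² (p/(1-p) + 1/(E Y))`. -/
theorem variance_lowDegCount (n k : ℕ) (p : ℝ) (hp0 : 0 ≤ p) (hp1 : p < 1)
    (hE : 0 < erExp n p (lowDegCount n k)) :
    erVar n p (lowDegCount n k) ≤
      (erExp n p (lowDegCount n k)) ^ 2 *
        (p / (1 - p) + 1 / erExp n p (lowDegCount n k)) := by
  have hq : 0 < 1 - p := sub_pos.2 hp1
  have hY : lowDegCount n k = fun G => ∑ v, lowDeg k v G.edgeFinset :=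
    funext (lowDegCount_eq_sum_lowDeg n k)
  set E := (⊤ : SimpleGraph (Fin n)).edgeFinset with hEdef
  have hmean : erExp n p (lowDegCount n k) = ∑ v, subsetExp p E (lowDeg k v) := by
    rw [hY, erExp_eq_subsetExp n p fun S => ∑ v, lowDeg k v S, subsetExp_sum]
  have hsecond : erExp n p (fun G => lowDegCount n k G ^ 2) =
      ∑ u, ∑ v, subsetExp p E (fun S => lowDeg k u S * lowDeg k v S) := by
    simp only [hY, sq, Finset.sum_mul_sum]
    rw [erExp_eq_subsetExp n p fun S => ∑ u, ∑ v, lowDeg k u S * lowDeg k v S, subsetExp_sum]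
    simp only [subsetExp_sum, ← hEdef]
  have hnonneg (v : Fin n) : 0 ≤ subsetExp p E (lowDeg k v) :=
    subsetExp_nonneg hp0 hp1.le fun S _ => lowDeg_nonneg v S
  have hpair (u v : Fin n) : subsetExp p E (fun S => lowDeg k u S * lowDeg k v S) ≤
      (if u = v then subsetExp p E (lowDeg k u) else 0) +
        subsetExp p E (lowDeg k u) * subsetExp p E (lowDeg k v) / (1 - p) := by
    have hprod := div_nonneg (mul_nonneg (hnonneg u) (hnonneg v)) hq.le
    split_ifs with huv
    · subst huv
      simp only [lowDeg_mul_self]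
      exact le_add_of_nonneg_right hprod
    · rw [zero_add, le_div_iff₀' hq]
      exact one_sub_mul_subsetExp_lowDeg_mul_le hp0 hp1.le huv (by simp [hEdef, huv])
  have hbound : erExp n p (fun G => lowDegCount n k G ^ 2) ≤
      erExp n p (lowDegCount n k) + erExp n p (lowDegCount n k) ^ 2 / (1 - p) := by
    rw [hsecond, hmean, sq, Finset.sum_mul_sum]
    refine (Finset.sum_le_sum fun u _ => Finset.sum_le_sum fun v _ => hpair u v).trans_eq ?_
    simp only [Finset.sum_add_distrib, Finset.sum_ite_eq, Finset.mem_univ, if_true,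
      Finset.sum_div]
  rw [erVar_eq]
  refine (sub_le_sub_right hbound _).trans_eq ?_
  field_simp
  ring
end

section
/- For every constant η > 0 there exist positive constants C₁ and C₂ such that for all sufficiently large n, all 0 ≤ p ≤ 1/√n, and every integer k with 0 < k ≤ (1−η)np, if X ~ Bin(n,p) then C₁ · (e^{−pn}/√k) · (epn/k)^k ≤ P(X ≤ k) ≤ C₂ · (e^{−pn}/√k) · (epn/k)^k. -/
open Nat in
/-- Upper Stirling bound with an explicit constant. -/
lemma factorial_le_exp_one_mul_sqrt_mul_pow {k : ℕ} (hk : 0 < k) :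
    (k ! : ℝ) ≤ Real.exp 1 * Real.sqrt k * (k / Real.exp 1) ^ k := by
  have hseq : Stirling.stirlingSeq k ≤ Real.exp 1 / Real.sqrt 2 := by
    have hanti := Stirling.stirlingSeq'_antitone (Nat.zero_le (k - 1))
    simp only [Function.comp, Nat.succ_eq_add_one, Nat.sub_add_cancel hk, zero_add] at hanti
    rwa [Stirling.stirlingSeq_one] at hanti
  have hkpos : (0 : ℝ) < k := by exact_mod_cast hk
  unfold Stirling.stirlingSeq at hseq
  rw [div_le_iff₀ (by positivity)] at hseq
  refine hseq.trans_eq ?_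
  rw [Real.sqrt_mul (by norm_num)]
  field_simp

open Nat in
/-- Lower Stirling bound without the constant `√(2π)`. -/
lemma sqrt_mul_pow_le_factorial (k : ℕ) :
    Real.sqrt k * (k / Real.exp 1) ^ k ≤ (k ! : ℝ) := by
  refine le_trans ?_ (Stirling.le_factorial_stirling k)
  gcongr
  nlinarith [Real.pi_gt_three, Nat.cast_nonneg (α := ℝ) k]

/-- For `p ≤ 1/2`, `e^{-p-2p²}` is a lower bound for `1 - p`. -/
lemma exp_neg_sub_two_mul_sq_le_one_sub {p : ℝ} (hp : p ≤ 1 / 2) :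
    Real.exp (-p - 2 * p ^ 2) ≤ 1 - p := by
  have hexp : 1 + p + 2 * p ^ 2 ≤ Real.exp (p + 2 * p ^ 2) := by
    linarith [Real.add_one_le_exp (p + 2 * p ^ 2)]
  rw [show -p - 2 * p ^ 2 = -(p + 2 * p ^ 2) by ring, Real.exp_neg,
    inv_le_iff_one_le_mul₀ (Real.exp_pos _)]
  calc (1 : ℝ) ≤ (1 - p) * (1 + p + 2 * p ^ 2) := by
        nlinarith [mul_nonneg (sq_nonneg p) (by linarith : 0 ≤ 1 - 2 * p)]
    _ ≤ (1 - p) * Real.exp (p + 2 * p ^ 2) := by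
        gcongr
        linarith

open Nat in
/-- Below its mode by a factor `1 - η`, the Poisson weights decay geometrically. -/
lemma pow_div_factorial_le_geometric {x r : ℝ} {k : ℕ} (hx : 0 < x) (hr : 0 ≤ r)
    (hk : (k : ℝ) ≤ r * x) (j : ℕ) (hj : j ≤ k) :
    x ^ (k - j) / ((k - j)! : ℝ) ≤ r ^ j * (x ^ k / (k ! : ℝ)) := by
  induction j with
  | zero => simp
  | succ j ih =>
    obtain ⟨m, rfl⟩ : ∃ m, k = m + 1 + j := ⟨k - (j + 1), by omega⟩
    have hprev := ih (by omega)
    rw [show m + 1 + j - j = m + 1 by omega] at hprev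
    rw [show m + 1 + j - (j + 1) = m by omega]
    have hm : ((m : ℝ) + 1) ≤ r * x := by
      refine le_trans ?_ hk
      push_cast
      linarith [Nat.cast_nonneg (α := ℝ) j]
    calc x ^ m / (m ! : ℝ) = (m + 1) / x * (x ^ (m + 1) / ((m + 1)! : ℝ)) := by
          rw [Nat.factorial_succ]
          push_cast
          field_simp
          ring
      _ ≤ r * (x ^ (m + 1) / ((m + 1)! : ℝ)) := by
          gcongr
          rwa [div_le_iff₀ hx]
      _ ≤ r * (r ^ j * (x ^ (m + 1 + j) / ((m + 1 + j)! : ℝ))) := by gcongr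
      _ = _ := by ring

open Nat in
/-- Partial exponential sums below the mode are controlled by their last term. -/
lemma sum_pow_div_factorial_le {x η : ℝ} {k : ℕ} (hx : 0 < x) (hη : 0 < η) (hη1 : η ≤ 1)
    (hk : (k : ℝ) ≤ (1 - η) * x) :
    ∑ i ∈ Finset.range (k + 1), x ^ i / (i ! : ℝ) ≤ 1 / η * (x ^ k / (k ! : ℝ)) := by
  rw [← Finset.sum_range_reflect]
  calc ∑ j ∈ Finset.range (k + 1), x ^ (k + 1 - 1 - j) / ((k + 1 - 1 - j)! : ℝ)
      ≤ ∑ j ∈ Finset.range (k + 1), (1 - η) ^ j * (x ^ k / (k ! : ℝ)) := by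
        refine Finset.sum_le_sum fun j hj => ?_
        rw [Nat.add_sub_cancel]
        exact pow_div_factorial_le_geometric hx (by linarith) hk j
          (Nat.lt_succ_iff.mp (Finset.mem_range.mp hj))
    _ = (∑ j ∈ Finset.range (k + 1), (1 - η) ^ j) * (x ^ k / (k ! : ℝ)) := by
        rw [Finset.sum_mul]
    _ ≤ 1 / η * (x ^ k / (k ! : ℝ)) := by
        gcongr
        rw [le_div_iff₀ hη]
        have hgeom := geom_sum_mul_neg (1 - η) (k + 1)
        rw [sub_sub_cancel] at hgeom
        rw [hgeom]
        linarith [pow_nonneg (by linarith : 0 ≤ 1 - η) (k + 1)]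

open Nat in
/-- Binomial weights are at most `e` times Poisson weights when `p i ≤ 1`. -/
lemma binomial_weight_le_poisson {n i : ℕ} {p : ℝ} (hp0 : 0 ≤ p) (hp1 : p ≤ 1) (hi : i ≤ n)
    (hpi : p * i ≤ 1) :
    (n.choose i : ℝ) * p ^ i * (1 - p) ^ (n - i) ≤
      Real.exp 1 * Real.exp (-(p * n)) * ((p * n) ^ i / (i ! : ℝ)) := by
  have hpow : (1 - p) ^ (n - i) ≤ Real.exp 1 * Real.exp (-(p * n)) := by
    calc (1 - p) ^ (n - i) ≤ Real.exp (-p) ^ (n - i) := by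
          refine pow_le_pow_left₀ (by linarith) ?_ _
          linarith [Real.add_one_le_exp (-p)]
      _ = Real.exp (p * i + -(p * n)) := by
          rw [← Real.exp_nat_mul, Nat.cast_sub hi]
          congr 1
          ring
      _ ≤ Real.exp (1 + -(p * n)) := by gcongr
      _ = _ := Real.exp_add _ _
  calc (n.choose i : ℝ) * p ^ i * (1 - p) ^ (n - i)
      ≤ ((n : ℝ) ^ i / (i ! : ℝ)) * p ^ i * (Real.exp 1 * Real.exp (-(p * n))) := by
        gcongr
        exact Nat.choose_le_pow_div i n
    _ = _ := by
        rw [mul_pow]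
        ring

open Nat in
/-- Lower bound on a binomial coefficient in the range `k² ≤ (1 - η) n`. -/
lemma mul_pow_div_factorial_le_choose {n k : ℕ} {η : ℝ} (hn : 0 < n) (hkn : k ≤ n)
    (hsq : (k : ℝ) ^ 2 ≤ (1 - η) * n) :
    η * ((n : ℝ) ^ k / (k ! : ℝ)) ≤ (n.choose k : ℝ) := by
  have hnpos : (0 : ℝ) < n := by exact_mod_cast hn
  have hkn' : (k : ℝ) ≤ n := by exact_mod_cast hkn
  have hratio : (k : ℝ) / n ≤ 1 := (div_le_one hnpos).mpr hkn'
  have hbern : η ≤ (1 - (k : ℝ) / n) ^ k := by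
    have h := one_add_mul_le_pow (a := -((k : ℝ) / n)) (by linarith) k
    rw [← sub_eq_add_neg] at h
    refine le_trans ?_ h
    have : (k : ℝ) ^ 2 / n ≤ 1 - η := (div_le_iff₀ hnpos).mpr hsq
    have heq : (k : ℝ) * -((k : ℝ) / n) = -((k : ℝ) ^ 2 / n) := by ring
    rw [heq]
    linarith
  calc η * ((n : ℝ) ^ k / (k ! : ℝ)) ≤ (1 - (k : ℝ) / n) ^ k * ((n : ℝ) ^ k / (k ! : ℝ)) := by
        gcongr
    _ = ((n : ℝ) - k) ^ k / (k ! : ℝ) := by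
        rw [← mul_div_assoc, ← mul_pow]
        congr 2
        field_simp
    _ ≤ ((n + 1 - k : ℕ) : ℝ) ^ k / (k ! : ℝ) := by
        rw [Nat.cast_sub (by omega)]
        push_cast
        gcongr
        linarith
    _ ≤ _ := by exact_mod_cast Nat.pow_le_choose k n

open Nat in
/-- Binomial weights are at least a constant times Poisson weights when `p² n ≤ 1` and
`k² ≤ (1 - η) n`. -/
lemma poisson_le_binomial_weight {n k : ℕ} {p η : ℝ} (hn : 0 < n) (hkn : k ≤ n) (hp0 : 0 ≤ p)
    (hp : p ≤ 1 / 2) (hpn : p ^ 2 * n ≤ 1) (hsq : (k : ℝ) ^ 2 ≤ (1 - η) * n) :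
    η * Real.exp (-2) * Real.exp (-(p * n)) * ((p * n) ^ k / (k ! : ℝ)) ≤
      (n.choose k : ℝ) * p ^ k * (1 - p) ^ (n - k) := by
  have hpow : Real.exp (-2) * Real.exp (-(p * n)) ≤ (1 - p) ^ (n - k) := by
    calc Real.exp (-2) * Real.exp (-(p * n)) ≤ Real.exp (-p - 2 * p ^ 2) ^ n := by
          rw [← Real.exp_add, ← Real.exp_nat_mul]
          gcongr
          linarith
      _ ≤ (1 - p) ^ n := by
          gcongr
          exact exp_neg_sub_two_mul_sq_le_one_sub hp
      _ ≤ (1 - p) ^ (n - k) :=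
          pow_le_pow_of_le_one (by linarith) (by linarith) (Nat.sub_le n k)
  calc η * Real.exp (-2) * Real.exp (-(p * n)) * ((p * n) ^ k / (k ! : ℝ))
      = η * ((n : ℝ) ^ k / (k ! : ℝ)) * p ^ k * (Real.exp (-2) * Real.exp (-(p * n))) := by
        rw [mul_pow]
        ring
    _ ≤ _ := by
        gcongr
        exact mul_pow_div_factorial_le_choose hn hkn hsq

/-- Sharp estimate for the lower tail of a binomial: for every `η > 0` there are constants
`C₁, C₂ > 0` such that for all large `n`, all `0 ≤ p ≤ 1/√n` and every integer
`0 < k ≤ (1-η)np`, `P(Bin(n,p) ≤ k)` is within constant factors of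
`(e^{-pn}/√k)(epn/k)^k`. -/
theorem binomial_lower_tail (η : ℝ) (hη : 0 < η) :
    ∃ C₁ > (0 : ℝ), ∃ C₂ > (0 : ℝ), ∃ N : ℕ, ∀ n ≥ N, ∀ p : ℝ,
      0 ≤ p → p ≤ 1 / Real.sqrt n → ∀ k : ℕ, 0 < k → (k : ℝ) ≤ (1 - η) * n * p →
      C₁ * (Real.exp (-(p * n)) / Real.sqrt k) * (Real.exp 1 * p * n / k) ^ k ≤
          (∑ i ∈ Finset.range (k + 1), (n.choose i : ℝ) * p ^ i * (1 - p) ^ (n - i)) ∧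
      (∑ i ∈ Finset.range (k + 1), (n.choose i : ℝ) * p ^ i * (1 - p) ^ (n - i)) ≤
          C₂ * (Real.exp (-(p * n)) / Real.sqrt k) * (Real.exp 1 * p * n / k) ^ k := by
  refine ⟨η * Real.exp (-2) / Real.exp 1, by positivity, Real.exp 1 * (1 / η), by positivity, 4,
    fun n hn p hp0 hp k hk hkle => ?_⟩
  have hn4 : (4 : ℝ) ≤ n := by exact_mod_cast hn
  have hnpos : (0 : ℝ) < n := by linarith
  have hkpos : (0 : ℝ) < k := by exact_mod_cast hk
  have hprod : 0 < (1 - η) * (n * p) := by linarith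
  have hη1 : 0 < 1 - η := pos_of_mul_pos_left hprod (by positivity)
  have hppos : 0 < p := by
    refine hp0.lt_of_ne fun h => ?_
    simp [← h] at hprod
  have hsqrt : 2 ≤ Real.sqrt n := Real.le_sqrt_of_sq_le (by linarith)
  have hpsqrt : p * Real.sqrt n ≤ 1 := (le_div_iff₀ (by linarith)).mp hp
  have hphalf : p ≤ 1 / 2 := by nlinarith
  have hpn : p ^ 2 * n ≤ 1 := by
    rw [← Real.sq_sqrt hnpos.le, ← mul_pow]
    exact pow_le_one₀ (by positivity) hpsqrt
  have hmean : (k : ℝ) ≤ (1 - η) * (p * n) := by linarith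
  have hkpn : (k : ℝ) ≤ p * n := by nlinarith
  have hkn : k ≤ n := by
    have : (k : ℝ) ≤ n := by nlinarith
    exact_mod_cast this
  have hksq : (k : ℝ) ^ 2 ≤ (1 - η) * n := by
    calc (k : ℝ) ^ 2 = k * k := sq _
      _ ≤ (1 - η) * (p * n) * (p * n) := by gcongr
      _ = (1 - η) * n * (p ^ 2 * n) := by ring
      _ ≤ (1 - η) * n * 1 := by gcongr
      _ = _ := mul_one _
  have htarget : ∀ C : ℝ,
      C * (Real.exp (-(p * n)) / Real.sqrt k) * (Real.exp 1 * p * n / k) ^ k =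
        C * Real.exp (-(p * n)) * ((p * n) ^ k / (Real.sqrt k * (k / Real.exp 1) ^ k)) := by
    intro C
    rw [mul_assoc (Real.exp 1), div_pow, div_pow, mul_pow (Real.exp 1)]
    field_simp
  rw [htarget, htarget]
  constructor
  · calc η * Real.exp (-2) / Real.exp 1 * Real.exp (-(p * n)) *
          ((p * n) ^ k / (Real.sqrt k * (k / Real.exp 1) ^ k))
        = η * Real.exp (-2) * Real.exp (-(p * n)) *
          ((p * n) ^ k / (Real.exp 1 * Real.sqrt k * (k / Real.exp 1) ^ k)) := by
          field_simp
      _ ≤ η * Real.exp (-2) * Real.exp (-(p * n)) * ((p * n) ^ k / (k.factorial : ℝ)) := by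
          gcongr
          exact factorial_le_exp_one_mul_sqrt_mul_pow hk
      _ ≤ (n.choose k : ℝ) * p ^ k * (1 - p) ^ (n - k) :=
          poisson_le_binomial_weight (by omega) hkn hp0 hphalf hpn hksq
      _ ≤ _ := by
          refine Finset.single_le_sum
            (f := fun i => (n.choose i : ℝ) * p ^ i * (1 - p) ^ (n - i))
            (fun i _ => ?_) (Finset.self_mem_range_succ k)
          have : 0 ≤ 1 - p := by linarith
          positivity
  · calc ∑ i ∈ Finset.range (k + 1), (n.choose i : ℝ) * p ^ i * (1 - p) ^ (n - i)
        ≤ ∑ i ∈ Finset.range (k + 1),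
            Real.exp 1 * Real.exp (-(p * n)) * ((p * n) ^ i / (i.factorial : ℝ)) := by
          refine Finset.sum_le_sum fun i hi => ?_
          have hik : i ≤ k := Nat.lt_succ_iff.mp (Finset.mem_range.mp hi)
          have hik' : (i : ℝ) ≤ k := by exact_mod_cast hik
          refine binomial_weight_le_poisson hp0 (by linarith) (hik.trans hkn) ?_
          calc p * i ≤ p * (p * n) := by gcongr; linarith
            _ = p ^ 2 * n := by ring
            _ ≤ 1 := hpn
      _ = Real.exp 1 * Real.exp (-(p * n)) *
            ∑ i ∈ Finset.range (k + 1), (p * n) ^ i / (i.factorial : ℝ) := by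
          rw [Finset.mul_sum]
      _ ≤ Real.exp 1 * Real.exp (-(p * n)) *
            (1 / η * ((p * n) ^ k / (Real.sqrt k * (k / Real.exp 1) ^ k))) := by
          gcongr
          refine (sum_pow_div_factorial_le (by positivity) hη (by linarith) hmean).trans ?_
          gcongr
          exact sqrt_mul_pow_le_factorial k
      _ = _ := by ring
end
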